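/- arXiv:1805.10005 — 3 statements merged into one kernel-verified Lean document; each statement's English description precedes it below -/
import Mathlib

section
/- Define A := Ψᵀ D_μ (I − γP) (I − λγP)⁻¹ Ψ and M := (1−λ) γ P (I − λγP)⁻¹. Then the N×N matrix I − Π_G M is invertible, A is invertible, and the identity Ψ A⁻¹ = (I − Π_G M)⁻¹ Ψ G⁻¹ holds. -/
open Matrix

/-- A stochastic matrix is nonexpansive in the weighted `L²` norm of a stationary distribution. -/
lemma sum_mul_sq_mulVec_le {n : Type*} [Fintype n] {μ : n → ℝ} (hμ : ∀ x, 0 ≤ μ x)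
    {P : Matrix n n ℝ} (hP0 : ∀ x y, 0 ≤ P x y) (hP1 : ∀ x, ∑ y, P x y = 1)
    (hstat : ∀ y, ∑ x, μ x * P x y = μ y) (u : n → ℝ) :
    ∑ x, μ x * (P *ᵥ u) x ^ 2 ≤ ∑ x, μ x * u x ^ 2 := by
  calc ∑ x, μ x * (P *ᵥ u) x ^ 2 ≤ ∑ x, μ x * ∑ y, P x y * u y ^ 2 := by
        gcongr with x
        · exact hμ x
        · exact Real.pow_arith_mean_le_arith_mean_pow_of_even _ _ _ (fun y _ => hP0 x y) (hP1 x)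
            even_two
    _ = ∑ y, (∑ x, μ x * P x y) * u y ^ 2 := by
        simp_rw [Finset.mul_sum, Finset.sum_mul]
        rw [Finset.sum_comm]
        simp_rw [mul_assoc]
    _ = ∑ x, μ x * u x ^ 2 := by simp_rw [hstat]

lemma sum_mul_sq_pos {n : Type*} [Fintype n] {μ : n → ℝ} (hμ : ∀ x, 0 < μ x) {u : n → ℝ}
    (hu : u ≠ 0) : 0 < ∑ x, μ x * u x ^ 2 := by
  obtain ⟨x, hx⟩ := Function.ne_iff.mp hu
  have hx : u x ≠ 0 := hx
  exact Finset.sum_pos' (fun y _ => by have := hμ y; positivity)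
    ⟨x, Finset.mem_univ x, by have := hμ x; positivity⟩

lemma sum_mul_sub_smul_mul_sub_smul_pos {n : Type*} [Fintype n] {μ : n → ℝ}
    (hμ : ∀ x, 0 < μ x) {P : Matrix n n ℝ} (hP0 : ∀ x y, 0 ≤ P x y)
    (hP1 : ∀ x, ∑ y, P x y = 1) (hstat : ∀ y, ∑ x, μ x * P x y = μ y) {a b : ℝ}
    (ha0 : 0 ≤ a) (ha : a < 1) (hb0 : 0 ≤ b) (hb : b < 1) {u : n → ℝ} (hu : u ≠ 0) :
    0 < ∑ x, μ x * ((u x - a * (P *ᵥ u) x) * (u x - b * (P *ᵥ u) x)) := by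
  have hS := sum_mul_sq_pos hμ hu
  have hT := sum_mul_sq_mulVec_le (fun x => (hμ x).le) hP0 hP1 hstat u
  have hT0 : 0 ≤ ∑ x, μ x * (P *ᵥ u) x ^ 2 :=
    Finset.sum_nonneg fun x _ => mul_nonneg (hμ x).le (sq_nonneg _)
  have hle : (1 - (a + b) / 2) * ∑ x, μ x * u x ^ 2
      + (a * b - (a + b) / 2) * ∑ x, μ x * (P *ᵥ u) x ^ 2
      ≤ ∑ x, μ x * ((u x - a * (P *ᵥ u) x) * (u x - b * (P *ᵥ u) x)) := by
    rw [Finset.mul_sum, Finset.mul_sum, ← Finset.sum_add_distrib]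
    gcongr with x
    have := mul_nonneg (mul_nonneg (hμ x).le (add_nonneg ha0 hb0))
      (sq_nonneg (u x - (P *ᵥ u) x))
    linarith
  refine lt_of_lt_of_le ?_ hle
  have hab : 0 < (1 - a) * (1 - b) := mul_pos (by linarith) (by linarith)
  have hcoef : 0 ≤ (a + b) / 2 - a * b := by
    nlinarith [mul_nonneg ha0 (sub_nonneg.2 hb.le), mul_nonneg hb0 (sub_nonneg.2 ha.le)]
  nlinarith [mul_pos hab hS, mul_nonneg hcoef (sub_nonneg.2 hT)]

lemma isUnit_of_dotProduct_mulVec_pos {n : Type*} [Fintype n] [DecidableEq n]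
    {A : Matrix n n ℝ} (hA : ∀ w, w ≠ 0 → 0 < w ⬝ᵥ A *ᵥ w) : IsUnit A := by
  rw [← mulVec_injective_iff_isUnit]
  refine (injective_iff_map_eq_zero A.mulVecLin).2 fun w hw => ?_
  by_contra hne
  have := hA w hne
  rw [mulVecLin_apply] at hw
  simp [hw] at this

lemma mulVec_injective_of_rank_eq {m n : Type*} [Fintype m] [Fintype n]
    {B : Matrix m n ℝ} (hB : B.rank = Fintype.card n) : Function.Injective B.mulVec := by
  have h := B.mulVecLin.finrank_range_add_finrank_ker
  rw [Module.finrank_fintype_fun_eq_card] at h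
  have hr : Module.finrank ℝ B.mulVecLin.range = Fintype.card n := hB
  have hk : Module.finrank ℝ B.mulVecLin.ker = 0 := by omega
  exact LinearMap.ker_eq_bot.1 (Submodule.finrank_eq_zero.1 hk)

lemma dotProduct_transpose_mul_diagonal_mul_mulVec {m n : Type*} [Fintype m] [Fintype n]
    [DecidableEq m] (μ : m → ℝ) (B C : Matrix m n ℝ) (w : n → ℝ) :
    w ⬝ᵥ (Bᵀ * diagonal μ * C) *ᵥ w = ∑ x, μ x * ((B *ᵥ w) x * (C *ᵥ w) x) := by
  rw [← mulVec_mulVec, ← mulVec_mulVec, dotProduct_mulVec, vecMul_transpose]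
  simp only [dotProduct, mulVec_diagonal]
  exact Finset.sum_congr rfl fun x _ => by ring

lemma isUnit_one_sub_smul_of_stochastic {n : Type*} [Fintype n] [DecidableEq n] {μ : n → ℝ}
    (hμ : ∀ x, 0 < μ x) {P : Matrix n n ℝ} (hP0 : ∀ x y, 0 ≤ P x y)
    (hP1 : ∀ x, ∑ y, P x y = 1) (hstat : ∀ y, ∑ x, μ x * P x y = μ y) {a : ℝ}
    (ha0 : 0 ≤ a) (ha : a < 1) : IsUnit (1 - a • P) := by
  rw [← mulVec_injective_iff_isUnit]
  refine (injective_iff_map_eq_zero (1 - a • P).mulVecLin).2 fun u hu => ?_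
  by_contra hne
  have hpos := sum_mul_sub_smul_mul_sub_smul_pos hμ hP0 hP1 hstat ha0 ha ha0 ha hne
  have hz : ∀ x, u x - a * (P *ᵥ u) x = 0 := fun x => by
    simpa [sub_mulVec, smul_mulVec] using congrFun hu x
  simp [hz] at hpos

/-- `I - Π_G M` and `A` are invertible and `Ψ A⁻¹ = (I - Π_G M)⁻¹ Ψ G⁻¹`,
where `M = (1-λ)γ P (I - λγP)⁻¹` and `A = Ψᵀ D_μ (I - γP)(I - λγP)⁻¹ Ψ`. -/
theorem stmt_11 (NN d : ℕ) (hN : 1 ≤ NN)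
    (μ : Fin NN → ℝ) (hμpos : ∀ x, 0 < μ x) (hμsum : ∑ x, μ x = 1)
    (P : Matrix (Fin NN) (Fin NN) ℝ)
    (hP0 : ∀ x y, 0 ≤ P x y) (hP1 : ∀ x, ∑ y, P x y = 1)
    (hstat : ∀ y, ∑ x, μ x * P x y = μ y)
    (γ lam : ℝ) (hγ : γ ∈ Set.Ioo (0 : ℝ) 1) (hlam : lam ∈ Set.Ico (0 : ℝ) 1)
    (Ψ : Matrix (Fin NN) (Fin d) ℝ) (hΨ : Ψ.rank = d) :
    let G := Ψᵀ * Matrix.diagonal μ * Ψ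
    let PiG := Ψ * G⁻¹ * Ψᵀ * Matrix.diagonal μ
    let M := ((1 - lam) * γ) •
      (P * ((1 : Matrix (Fin NN) (Fin NN) ℝ) - (lam * γ) • P)⁻¹)
    let A := Ψᵀ * Matrix.diagonal μ *
      (((1 : Matrix (Fin NN) (Fin NN) ℝ) - γ • P) *
        ((1 : Matrix (Fin NN) (Fin NN) ℝ) - (lam * γ) • P)⁻¹) * Ψ
    IsUnit ((1 : Matrix (Fin NN) (Fin NN) ℝ) - PiG * M) ∧
    IsUnit A ∧
    Ψ * A⁻¹ = ((1 : Matrix (Fin NN) (Fin NN) ℝ) - PiG * M)⁻¹ * Ψ * G⁻¹ := by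
  intro G PiG M A
  obtain ⟨hγ0, hγ1⟩ := hγ
  obtain ⟨hl0, hl1⟩ := hlam
  have hc0 : 0 ≤ lam * γ := by positivity
  have hc1 : lam * γ < 1 := by nlinarith
  have hΨinj : Function.Injective Ψ.mulVec := mulVec_injective_of_rank_eq (by simpa using hΨ)
  have hΨne : ∀ w, w ≠ 0 → Ψ *ᵥ w ≠ 0 := fun w hw h => hw (hΨinj (by simpa using h))
  have hK := isUnit_one_sub_smul_of_stochastic hμpos hP0 hP1 hstat hc0 hc1
  set K := 1 - (lam * γ) • P with hKdef
  have hKdet := (isUnit_iff_isUnit_det K).1 hK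
  have hG : IsUnit G := isUnit_of_dotProduct_mulVec_pos fun w hw => by
    rw [dotProduct_transpose_mul_diagonal_mul_mulVec]
    simpa only [sq] using sum_mul_sq_pos hμpos (hΨne w hw)
  have hA : IsUnit A := isUnit_of_dotProduct_mulVec_pos fun w hw => by
    have hu : K *ᵥ (K⁻¹ *ᵥ (Ψ *ᵥ w)) = Ψ *ᵥ w := by
      rw [mulVec_mulVec, mul_nonsing_inv _ hKdet, one_mulVec]
    have hne : K⁻¹ *ᵥ (Ψ *ᵥ w) ≠ 0 := fun h => hΨne w hw (by rw [← hu, h, mulVec_zero])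
    have hpos := sum_mul_sub_smul_mul_sub_smul_pos hμpos hP0 hP1 hstat hc0 hc1 hγ0.le hγ1 hne
    simp only [A]
    rw [Matrix.mul_assoc (Ψᵀ * diagonal μ), dotProduct_transpose_mul_diagonal_mul_mulVec,
      ← mulVec_mulVec, ← mulVec_mulVec]
    nth_rewrite 1 [← hu]
    generalize K⁻¹ *ᵥ (Ψ *ᵥ w) = u at hpos ⊢
    simpa [hKdef, sub_mulVec, smul_mulVec] using hpos
  have hGdet := (isUnit_iff_isUnit_det G).1 hG
  have hAdet := (isUnit_iff_isUnit_det A).1 hA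
  have hM : (1 - γ • P) * K⁻¹ = 1 - M := by
    have h : 1 - γ • P = K - ((1 - lam) * γ) • P := by
      rw [hKdef]
      module
    rw [h, Matrix.sub_mul, mul_nonsing_inv _ hKdet, Matrix.smul_mul]
  have hAG : A = G - Ψᵀ * diagonal μ * M * Ψ := by
    simp only [A, G]
    rw [hM, Matrix.mul_sub, Matrix.sub_mul, Matrix.mul_one]
  have hGA : G⁻¹ * A = 1 - G⁻¹ * (Ψᵀ * diagonal μ * M) * Ψ := by
    rw [hAG, Matrix.mul_sub, nonsing_inv_mul _ hGdet]
    simp only [Matrix.mul_assoc]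
  have hPiM : PiG * M = Ψ * (G⁻¹ * (Ψᵀ * diagonal μ * M)) := by
    simp only [PiG, Matrix.mul_assoc]
  have hunit : IsUnit (1 - PiG * M) := by
    rw [isUnit_iff_isUnit_det, hPiM, det_one_sub_mul_comm, ← hGA, det_mul]
    exact (isUnit_nonsing_inv_det _ hGdet).mul hAdet
  have hdet := (isUnit_iff_isUnit_det _).1 hunit
  have hcomm : (1 - PiG * M) * Ψ = Ψ * G⁻¹ * A := by
    rw [Matrix.mul_assoc Ψ, hGA, hPiM, Matrix.sub_mul, Matrix.mul_sub, Matrix.one_mul,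
      Matrix.mul_one, Matrix.mul_assoc Ψ]
  refine ⟨hunit, hA, ?_⟩
  calc Ψ * A⁻¹ = (1 - PiG * M)⁻¹ * ((1 - PiG * M) * Ψ) * A⁻¹ := by
        rw [nonsing_inv_mul_cancel_left _ _ hdet]
    _ = (1 - PiG * M)⁻¹ * Ψ * G⁻¹ := by
        rw [hcomm, ← Matrix.mul_assoc, mul_nonsing_inv_cancel_right _ _ hAdet, ← Matrix.mul_assoc]
end

section
/- Define A := Ψᵀ D_μ (I − γP) (I − λγP)⁻¹ Ψ, and let ν_G > 0 be the smallest eigenvalue of the (symmetric positive definite) Gram matrix G = Ψᵀ D_μ Ψ. Then A is invertible and for every g ∈ ℝ^d, ‖A⁻¹ g‖₂ ≤ ((1−λγ)/((1−γ) ν_G)) ‖g‖₂, where ‖·‖₂ denotes the Euclidean norm on ℝ^d. -/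
open Matrix

/-- A Markov operator is a contraction of the `μ`-weighted `ℓ²` norm when `μ` is stationary. -/
lemma sum_mul_mulVec_sq_le {X : Type*} [Fintype X] {μ : X → ℝ} (hμ : ∀ x, 0 ≤ μ x)
    {P : Matrix X X ℝ} (hP0 : ∀ x y, 0 ≤ P x y) (hP1 : ∀ x, ∑ y, P x y = 1)
    (hstat : ∀ y, ∑ x, μ x * P x y = μ y) (w : X → ℝ) :
    ∑ x, μ x * (P *ᵥ w) x ^ 2 ≤ ∑ x, μ x * w x ^ 2 := by
  have jensen (x : X) : (P *ᵥ w) x ^ 2 ≤ ∑ y, P x y * w y ^ 2 := by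
    simpa [mulVec, dotProduct] using
      (even_two.convexOn_pow (𝕜 := ℝ)).map_sum_le (t := Finset.univ) (p := w)
        (fun y _ => hP0 x y) (hP1 x) (fun _ _ => Set.mem_univ _)
  calc ∑ x, μ x * (P *ᵥ w) x ^ 2
      ≤ ∑ x, μ x * ∑ y, P x y * w y ^ 2 :=
        Finset.sum_le_sum fun x _ => mul_le_mul_of_nonneg_left (jensen x) (hμ x)
    _ = ∑ y, (∑ x, μ x * P x y) * w y ^ 2 := by
        simp only [Finset.mul_sum, Finset.sum_mul, mul_assoc]
        exact Finset.sum_comm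
    _ = ∑ y, μ y * w y ^ 2 := by simp only [hstat]

/-- `I - aP` is invertible for a stochastic matrix `P` with positive stationary distribution and
`0 ≤ a < 1`. -/
lemma isUnit_one_sub_smul {X : Type*} [Fintype X] [DecidableEq X] {μ : X → ℝ}
    (hμ : ∀ x, 0 < μ x) {P : Matrix X X ℝ} (hP0 : ∀ x y, 0 ≤ P x y)
    (hP1 : ∀ x, ∑ y, P x y = 1) (hstat : ∀ y, ∑ x, μ x * P x y = μ y)
    {a : ℝ} (ha0 : 0 ≤ a) (ha1 : a < 1) : IsUnit (1 - a • P) := by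
  rw [← mulVec_injective_iff_isUnit]
  refine (injective_iff_map_eq_zero (1 - a • P).mulVecLin).2 fun w hw => ?_
  have hfix (x : X) : w x = a * (P *ᵥ w) x := by
    have := congrFun hw x
    simp at this
    linarith
  have hcontr := sum_mul_mulVec_sq_le (fun x => (hμ x).le) hP0 hP1 hstat w
  have hnorm : ∑ x, μ x * w x ^ 2 = a ^ 2 * ∑ x, μ x * (P *ᵥ w) x ^ 2 := by
    rw [Finset.mul_sum]
    refine Finset.sum_congr rfl fun x _ => ?_
    rw [hfix x]
    ring
  have hnonneg (x : X) : 0 ≤ μ x * w x ^ 2 := mul_nonneg (hμ x).le (sq_nonneg _)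
  have ha2 : 0 < 1 - a ^ 2 := by nlinarith
  have hle := hnorm.le.trans (mul_le_mul_of_nonneg_left hcontr (sq_nonneg a))
  have hsum : ∑ x, μ x * w x ^ 2 = 0 :=
    le_antisymm (nonpos_of_mul_nonpos_right (by linarith) ha2) (Finset.sum_nonneg fun x _ => hnonneg x)
  ext x
  have := (Finset.sum_eq_zero_iff_of_nonneg fun x _ => hnonneg x).1 hsum x (Finset.mem_univ x)
  simpa [(hμ x).ne'] using this

/-- Coercivity of `(I - γP)(I - aP)⁻¹` in the `μ`-weighted inner product, written in terms of
`w = (I - aP)⁻¹ v`. -/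
lemma resolvent_coercive {X : Type*} [Fintype X] {μ : X → ℝ} (hμ : ∀ x, 0 ≤ μ x)
    {P : Matrix X X ℝ} (hP0 : ∀ x y, 0 ≤ P x y) (hP1 : ∀ x, ∑ y, P x y = 1)
    (hstat : ∀ y, ∑ x, μ x * P x y = μ y) {a γ : ℝ} (haγ : a ≤ γ) (ha0 : 0 ≤ a) (ha1 : a < 1)
    (w : X → ℝ) :
    (1 - γ) * ∑ x, μ x * (w x - a * (P *ᵥ w) x) ^ 2 ≤
      (1 - a) * ∑ x, μ x * ((w x - a * (P *ᵥ w) x) * (w x - γ * (P *ᵥ w) x)) := by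
  have hcontr := sum_mul_mulVec_sq_le hμ hP0 hP1 hstat w
  have hsq : 0 ≤ ∑ x, μ x * (w x - (P *ᵥ w) x) ^ 2 :=
    Finset.sum_nonneg fun x _ => mul_nonneg (hμ x) (sq_nonneg _)
  have hdiff : (1 - a) * ∑ x, μ x * ((w x - a * (P *ᵥ w) x) * (w x - γ * (P *ᵥ w) x)) -
      (1 - γ) * ∑ x, μ x * (w x - a * (P *ᵥ w) x) ^ 2 =
      (γ - a) * ((1 - a) * (∑ x, μ x * w x ^ 2 - ∑ x, μ x * (P *ᵥ w) x ^ 2) +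
        (1 + a) * ∑ x, μ x * (w x - (P *ᵥ w) x) ^ 2) / 2 := by
    simp only [Finset.mul_sum, ← Finset.sum_sub_distrib, ← Finset.sum_add_distrib,
      Finset.sum_div]
    refine Finset.sum_congr rfl fun x _ => ?_
    ring
  have hpos := mul_nonneg (sub_nonneg.2 haγ) (add_nonneg
    (mul_nonneg (sub_nonneg.2 ha1.le) (sub_nonneg.2 hcontr))
    (mul_nonneg (by linarith : 0 ≤ 1 + a) hsq))
  linarith

/-- The quadratic form of a real symmetric matrix is bounded below by any lower bound on its
eigenvalues. -/
lemma Matrix.IsHermitian.mul_dotProduct_self_le {n : Type*} [Fintype n] [DecidableEq n]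
    {G : Matrix n n ℝ} (hG : G.IsHermitian) {c : ℝ} (hc : ∀ i, c ≤ hG.eigenvalues i)
    (x : n → ℝ) : c * (x ⬝ᵥ x) ≤ x ⬝ᵥ G *ᵥ x := by
  have hH : (G - algebraMap ℝ _ c).IsHermitian :=
    hG.sub (by simp [Matrix.algebraMap_eq_diagonal])
  have hpsd : (G - algebraMap ℝ _ c).PosSemidef := by
    refine hH.posSemidef_iff_eigenvalues_nonneg.2 fun i => ?_
    have hmem := hH.eigenvalues_mem_spectrum_real i
    rw [← spectrum.sub_singleton_eq, hG.spectrum_real_eq_range_eigenvalues] at hmem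
    obtain ⟨_, ⟨j, rfl⟩, _, rfl, hj⟩ := hmem
    have := hc j
    simp only [Pi.zero_apply]
    linarith
  have := hpsd.dotProduct_mulVec_nonneg x
  simp [Algebra.algebraMap_eq_smul_one, sub_mulVec, smul_mulVec, dotProduct_sub] at this
  exact this

/-- A matrix whose quadratic form is bounded below by `c > 0` is invertible, and its inverse is
bounded by `c⁻¹` in the Euclidean norm. -/
lemma isUnit_and_sqrt_inv_mulVec_le {n : Type*} [Fintype n] [DecidableEq n]
    {A : Matrix n n ℝ} {c : ℝ} (hc : 0 < c) (hA : ∀ x, c * (x ⬝ᵥ x) ≤ x ⬝ᵥ A *ᵥ x) :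
    IsUnit A ∧ ∀ g : n → ℝ,
      Real.sqrt (∑ i, (A⁻¹ *ᵥ g) i ^ 2) ≤ c⁻¹ * Real.sqrt (∑ i, g i ^ 2) := by
  have hunit : IsUnit A := by
    rw [← mulVec_injective_iff_isUnit]
    refine (injective_iff_map_eq_zero A.mulVecLin).2 fun x hx => ?_
    have hx' : A *ᵥ x = 0 := hx
    have h := hA x
    rw [hx', dotProduct_zero] at h
    have h0 : 0 ≤ x ⬝ᵥ x := Finset.sum_nonneg fun i _ => mul_self_nonneg (x i)
    exact dotProduct_self_eq_zero.1 (le_antisymm (by nlinarith) h0)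
  refine ⟨hunit, fun g => ?_⟩
  set x := A⁻¹ *ᵥ g
  have hAx : A *ᵥ x = g := by
    rw [mulVec_mulVec, mul_nonsing_inv _ ((isUnit_iff_isUnit_det A).1 hunit), one_mulVec]
  have h := hA x
  have hxx : x ⬝ᵥ x = Real.sqrt (∑ i, x i ^ 2) * Real.sqrt (∑ i, x i ^ 2) := by
    rw [Real.mul_self_sqrt (Finset.sum_nonneg fun i _ => sq_nonneg (x i))]
    simp [dotProduct, sq]
  have hcs : x ⬝ᵥ g ≤ Real.sqrt (∑ i, x i ^ 2) * Real.sqrt (∑ i, g i ^ 2) :=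
    Real.sum_mul_le_sqrt_mul_sqrt _ x g
  rw [le_inv_mul_iff₀ hc]
  rcases (Real.sqrt_nonneg (∑ i, x i ^ 2)).eq_or_lt with h0 | hpos
  · rw [← h0, mul_zero]
    exact Real.sqrt_nonneg _
  · refine le_of_mul_le_mul_left ?_ hpos
    rw [hAx, hxx] at h
    linarith

/-- If `ν_G > 0` is the smallest eigenvalue of the Gram matrix `G = Ψᵀ D_μ Ψ`,
then `A = Ψᵀ D_μ (I - γP)(I - λγP)⁻¹ Ψ` is invertible and
`‖A⁻¹ g‖₂ ≤ ((1-λγ)/((1-γ) ν_G)) ‖g‖₂` for every `g : ℝ^d`. -/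
theorem stmt_13 (NN d : ℕ) (hN : 1 ≤ NN)
    (μ : Fin NN → ℝ) (hμpos : ∀ x, 0 < μ x) (hμsum : ∑ x, μ x = 1)
    (P : Matrix (Fin NN) (Fin NN) ℝ)
    (hP0 : ∀ x y, 0 ≤ P x y) (hP1 : ∀ x, ∑ y, P x y = 1)
    (hstat : ∀ y, ∑ x, μ x * P x y = μ y)
    (γ lam : ℝ) (hγ : γ ∈ Set.Ioo (0 : ℝ) 1) (hlam : lam ∈ Set.Ico (0 : ℝ) 1)
    (Ψ : Matrix (Fin NN) (Fin d) ℝ) (hΨ : Ψ.rank = d)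
    (hG : (Ψᵀ * Matrix.diagonal μ * Ψ).IsHermitian)
    (νG : ℝ) (hνG : IsLeast (Set.range hG.eigenvalues) νG) (hνGpos : 0 < νG) :
    let A := Ψᵀ * Matrix.diagonal μ *
      (((1 : Matrix (Fin NN) (Fin NN) ℝ) - γ • P) *
        ((1 : Matrix (Fin NN) (Fin NN) ℝ) - (lam * γ) • P)⁻¹) * Ψ
    IsUnit A ∧
    ∀ g : Fin d → ℝ,
      Real.sqrt (∑ i, (A⁻¹.mulVec g i) ^ 2) ≤
        ((1 - lam * γ) / ((1 - γ) * νG)) * Real.sqrt (∑ i, g i ^ 2) := by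
  obtain ⟨hγ0, hγ1⟩ := hγ
  obtain ⟨hl0, hl1⟩ := hlam
  intro A
  have ha0 : 0 ≤ lam * γ := mul_nonneg hl0 hγ0.le
  have haγ : lam * γ ≤ γ := mul_le_of_le_one_left hγ0.le hl1.le
  have ha1 : lam * γ < 1 := haγ.trans_lt hγ1
  have hμ0 (x : Fin NN) : 0 ≤ μ x := (hμpos x).le
  have hQ := isUnit_one_sub_smul hμpos hP0 hP1 hstat ha0 ha1
  have hform (B : Matrix (Fin NN) (Fin NN) ℝ) (x : Fin d → ℝ) :
      x ⬝ᵥ (Ψᵀ * Matrix.diagonal μ * B * Ψ) *ᵥ x =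
        ∑ i, μ i * ((Ψ *ᵥ x) i * (B *ᵥ (Ψ *ᵥ x)) i) := by
    simp only [← mulVec_mulVec]
    rw [dotProduct_mulVec, vecMul_transpose]
    simp only [dotProduct, mulVec_diagonal]
    exact Finset.sum_congr rfl fun i _ => mul_left_comm _ _ _
  have hcoer (x : Fin d → ℝ) :
      ((1 - γ) * νG / (1 - lam * γ)) * (x ⬝ᵥ x) ≤ x ⬝ᵥ A *ᵥ x := by
    have hgram := hG.mul_dotProduct_self_le (fun i => hνG.2 ⟨i, rfl⟩) x
    have hgram_form := hform 1 x
    rw [Matrix.mul_one] at hgram_form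
    set w := (1 - (lam * γ) • P)⁻¹ *ᵥ (Ψ *ᵥ x) with hw
    have hv (i : Fin NN) : (Ψ *ᵥ x) i = w i - lam * γ * (P *ᵥ w) i := by
      have : (1 - (lam * γ) • P) *ᵥ w = Ψ *ᵥ x := by
        rw [hw, mulVec_mulVec, mul_nonsing_inv _ ((isUnit_iff_isUnit_det _).1 hQ), one_mulVec]
      simp [← this, sub_mulVec, smul_mulVec]
    have hA : x ⬝ᵥ A *ᵥ x = ∑ i, μ i *
        ((w i - lam * γ * (P *ᵥ w) i) * (w i - γ * (P *ᵥ w) i)) := by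
      rw [hform]
      refine Finset.sum_congr rfl fun i _ => ?_
      rw [← mulVec_mulVec, ← hw, hv]
      simp [sub_mulVec, smul_mulVec]
    have hres := resolvent_coercive hμ0 hP0 hP1 hstat haγ ha0 ha1 w
    rw [← hA] at hres
    simp only [one_mulVec, hv, ← sq] at hgram_form
    rw [← hgram_form] at hres
    rw [div_mul_eq_mul_div, div_le_iff₀ (sub_pos.2 ha1), mul_comm (x ⬝ᵥ A *ᵥ x), mul_assoc]
    exact (mul_le_mul_of_nonneg_left hgram (sub_nonneg.2 hγ1.le)).trans hres
  have hc : 0 < (1 - γ) * νG / (1 - lam * γ) :=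
    div_pos (mul_pos (sub_pos.2 hγ1) hνGpos) (sub_pos.2 ha1)
  simpa only [inv_div] using isUnit_and_sqrt_inv_mulVec_le hc hcoer
end

section
/- Let V ∈ ℝ^N be the (unique) fixed point of the Bellman operator, V = r + γ P V, and let V̄ ∈ ℝ^N be the unique fixed point of the projected multi-step Bellman operator, V̄ = Π_G T^λ V̄. Then ‖V − V̄‖_μ ≤ ((1−λγ)/(1−γ)) ‖V − Π_G V‖_μ. -/
open Matrix

section WeightedNorm

variable {ι κ : Type*} [Fintype ι] [Fintype κ]

/-- The `L²` norm of `v` weighted by `μ`. -/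
noncomputable def weightedNorm (μ v : ι → ℝ) : ℝ := Real.sqrt (∑ x, μ x * v x ^ 2)

lemma weightedNorm_eq_norm {μ : ι → ℝ} (hμ : ∀ x, 0 ≤ μ x) (v : ι → ℝ) :
    weightedNorm μ v = ‖WithLp.toLp 2 (fun x => Real.sqrt (μ x) * v x)‖ := by
  rw [weightedNorm, EuclideanSpace.norm_eq]
  congr 1
  refine Finset.sum_congr rfl fun x _ => ?_
  rw [Real.norm_eq_abs, sq_abs, mul_pow, Real.sq_sqrt (hμ x)]

lemma weightedNorm_add_le {μ : ι → ℝ} (hμ : ∀ x, 0 ≤ μ x) (u v : ι → ℝ) :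
    weightedNorm μ (u + v) ≤ weightedNorm μ u + weightedNorm μ v := by
  simp only [weightedNorm_eq_norm hμ]
  refine le_of_eq_of_le (congrArg norm ?_) (norm_add_le _ _)
  ext x
  simp [mul_add]

lemma weightedNorm_smul {μ : ι → ℝ} (hμ : ∀ x, 0 ≤ μ x) {c : ℝ} (hc : 0 ≤ c) (v : ι → ℝ) :
    weightedNorm μ (c • v) = c * weightedNorm μ v := by
  simp only [weightedNorm_eq_norm hμ]
  rw [← abs_of_nonneg hc, ← Real.norm_eq_abs, ← norm_smul, Real.norm_eq_abs, abs_of_nonneg hc]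
  congr 1
  ext x
  simp [mul_left_comm]

lemma eq_zero_of_weightedNorm_nonpos {μ : ι → ℝ} (hμ : ∀ x, 0 < μ x) {v : ι → ℝ}
    (h : weightedNorm μ v ≤ 0) : v = 0 := by
  rw [weightedNorm_eq_norm fun x => (hμ x).le, norm_le_zero_iff] at h
  ext x
  have hx := congrArg (fun w : EuclideanSpace ℝ ι => w x) h
  simpa [(Real.sqrt_pos.2 (hμ x)).ne'] using hx

/-- A stochastic matrix is nonexpansive in the norm weighted by a stationary measure. -/
lemma weightedNorm_mulVec_le {μ : ι → ℝ} (hμ : ∀ x, 0 ≤ μ x) {P : Matrix ι ι ℝ}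
    (hP0 : ∀ x y, 0 ≤ P x y) (hP1 : ∀ x, ∑ y, P x y = 1)
    (hstat : ∀ y, ∑ x, μ x * P x y = μ y) (v : ι → ℝ) :
    weightedNorm μ (P *ᵥ v) ≤ weightedNorm μ v := by
  refine Real.sqrt_le_sqrt ?_
  calc ∑ x, μ x * (P *ᵥ v) x ^ 2
      ≤ ∑ x, μ x * ∑ y, P x y * v y ^ 2 :=
        Finset.sum_le_sum fun x _ => mul_le_mul_of_nonneg_left
          (Real.pow_arith_mean_le_arith_mean_pow_of_even _ _ _ (fun y _ => hP0 x y) (hP1 x)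
            even_two) (hμ x)
    _ = ∑ y, (∑ x, μ x * P x y) * v y ^ 2 := by
        simp only [Finset.mul_sum, Finset.sum_mul, mul_assoc]
        exact Finset.sum_comm
    _ = ∑ y, μ y * v y ^ 2 := by simp only [hstat]

/-- The weighted projection onto a column space is nonexpansive in the weighted norm. If the Gram
matrix is singular, its inverse is zero by convention and the bound is trivial. -/
lemma weightedNorm_projection_le [DecidableEq ι] [DecidableEq κ] {μ : ι → ℝ}
    (hμ : ∀ x, 0 ≤ μ x) (Ψ : Matrix ι κ ℝ) (v : ι → ℝ) :
    weightedNorm μ ((Ψ * (Ψᵀ * diagonal μ * Ψ)⁻¹ * Ψᵀ * diagonal μ) *ᵥ v) ≤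
      weightedNorm μ v := by
  by_cases hG : IsUnit (Ψᵀ * diagonal μ * Ψ).det
  · obtain ⟨w, hw⟩ : ∃ w, w = (Ψᵀ * diagonal μ * Ψ)⁻¹ *ᵥ (Ψᵀ *ᵥ (diagonal μ *ᵥ v)) := ⟨_, rfl⟩
    have hproj : (Ψ * (Ψᵀ * diagonal μ * Ψ)⁻¹ * Ψᵀ * diagonal μ) *ᵥ v = Ψ *ᵥ w := by
      simp only [hw, mulVec_mulVec, Matrix.mul_assoc]
    have horth : Ψᵀ *ᵥ (diagonal μ *ᵥ (v - Ψ *ᵥ w)) = 0 := by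
      have h : (Ψᵀ * diagonal μ * Ψ) *ᵥ w = Ψᵀ *ᵥ (diagonal μ *ᵥ v) := by
        rw [hw, mulVec_mulVec, mul_nonsing_inv _ hG, one_mulVec]
      rw [mulVec_sub, mulVec_sub, ← h]
      simp only [mulVec_mulVec, Matrix.mul_assoc, sub_self]
    have hinner : ∑ x, (Ψ *ᵥ w) x * (μ x * (v x - (Ψ *ᵥ w) x)) = 0 := by
      have h : w ⬝ᵥ (Ψᵀ *ᵥ (diagonal μ *ᵥ (v - Ψ *ᵥ w))) = 0 := by rw [horth, dotProduct_zero]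
      rw [dotProduct_mulVec, vecMul_transpose] at h
      simpa [dotProduct, mulVec_diagonal] using h
    rw [hproj]
    refine Real.sqrt_le_sqrt ?_
    have hpyth : ∑ x, μ x * v x ^ 2 = ∑ x, μ x * (Ψ *ᵥ w) x ^ 2 +
        ∑ x, μ x * (v x - (Ψ *ᵥ w) x) ^ 2 +
          2 * ∑ x, (Ψ *ᵥ w) x * (μ x * (v x - (Ψ *ᵥ w) x)) := by
      rw [Finset.mul_sum, ← Finset.sum_add_distrib, ← Finset.sum_add_distrib]
      exact Finset.sum_congr rfl fun x _ => by ring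
    have hres : 0 ≤ ∑ x, μ x * (v x - (Ψ *ᵥ w) x) ^ 2 :=
      Finset.sum_nonneg fun x _ => mul_nonneg (hμ x) (sq_nonneg _)
    linarith
  · rw [nonsing_inv_apply_not_isUnit _ hG]
    simp [weightedNorm]

/-- The resolvent bound `(1 - a) ‖u‖ ≤ ‖u - a P u‖` for a stochastic matrix `P`. -/
lemma weightedNorm_le_sub_smul_mulVec [DecidableEq ι] {μ : ι → ℝ} (hμ : ∀ x, 0 ≤ μ x)
    {P : Matrix ι ι ℝ} (hP0 : ∀ x y, 0 ≤ P x y) (hP1 : ∀ x, ∑ y, P x y = 1)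
    (hstat : ∀ y, ∑ x, μ x * P x y = μ y) {a : ℝ} (ha : 0 ≤ a) (u : ι → ℝ) :
    (1 - a) * weightedNorm μ u ≤ weightedNorm μ ((1 - a • P) *ᵥ u) := by
  have h := weightedNorm_add_le hμ ((1 - a • P) *ᵥ u) (a • (P *ᵥ u))
  rw [sub_mulVec, one_mulVec, smul_mulVec, sub_add_cancel, weightedNorm_smul hμ ha] at h
  have hP := mul_le_mul_of_nonneg_left (weightedNorm_mulVec_le hμ hP0 hP1 hstat u) ha
  rw [sub_mulVec, one_mulVec, smul_mulVec]
  linarith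

lemma isUnit_det_one_sub_smul [DecidableEq ι] {μ : ι → ℝ} (hμ : ∀ x, 0 < μ x)
    {P : Matrix ι ι ℝ} (hP0 : ∀ x y, 0 ≤ P x y) (hP1 : ∀ x, ∑ y, P x y = 1)
    (hstat : ∀ y, ∑ x, μ x * P x y = μ y) {a : ℝ} (ha : 0 ≤ a) (ha1 : a < 1) :
    IsUnit (1 - a • P).det := by
  rw [isUnit_iff_ne_zero]
  intro hdet
  obtain ⟨u, hu, hu0⟩ := exists_mulVec_eq_zero_iff.2 hdet
  refine hu (eq_zero_of_weightedNorm_nonpos hμ ?_)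
  have h := weightedNorm_le_sub_smul_mulVec (fun x => (hμ x).le) hP0 hP1 hstat ha u
  have hzero : weightedNorm μ (0 : ι → ℝ) = 0 := by simp [weightedNorm]
  rw [hu0, hzero] at h
  exact nonpos_of_mul_nonpos_right h (by linarith)

end WeightedNorm

/-- If `V = r + γ P V` is the true value function and `V̄ = Π_G T^λ V̄` is the
fixed point of the projected multi-step Bellman operator, then
`‖V - V̄‖_μ ≤ ((1-λγ)/(1-γ)) ‖V - Π_G V‖_μ`. -/
theorem stmt_14 (NN d : ℕ) (hN : 1 ≤ NN)
    (μ : Fin NN → ℝ) (hμpos : ∀ x, 0 < μ x) (hμsum : ∑ x, μ x = 1)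
    (P : Matrix (Fin NN) (Fin NN) ℝ)
    (hP0 : ∀ x y, 0 ≤ P x y) (hP1 : ∀ x, ∑ y, P x y = 1)
    (hstat : ∀ y, ∑ x, μ x * P x y = μ y)
    (γ lam : ℝ) (hγ : γ ∈ Set.Ioo (0 : ℝ) 1) (hlam : lam ∈ Set.Ico (0 : ℝ) 1)
    (r : Fin NN → ℝ)
    (Ψ : Matrix (Fin NN) (Fin d) ℝ) (hΨ : Ψ.rank = d)
    (Tlam : (Fin NN → ℝ) → (Fin NN → ℝ))
    (hTlam : ∀ v, Tlam v =
      ((1 : Matrix (Fin NN) (Fin NN) ℝ) - (lam * γ) • P)⁻¹.mulVec r +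
        ((1 - lam) * γ) •
          P.mulVec (((1 : Matrix (Fin NN) (Fin NN) ℝ) - (lam * γ) • P)⁻¹.mulVec v))
    (PiG : Matrix (Fin NN) (Fin NN) ℝ)
    (hPiG : PiG = Ψ * (Ψᵀ * Matrix.diagonal μ * Ψ)⁻¹ * Ψᵀ * Matrix.diagonal μ)
    (V Vbar : Fin NN → ℝ)
    (hV : V = r + γ • P.mulVec V)
    (hVbar : Vbar = PiG.mulVec (Tlam Vbar)) :
    Real.sqrt (∑ x, μ x * (V x - Vbar x) ^ 2) ≤
      ((1 - lam * γ) / (1 - γ)) *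
        Real.sqrt (∑ x, μ x * (V x - PiG.mulVec V x) ^ 2) := by
  obtain ⟨hγ0, hγ1⟩ := hγ
  obtain ⟨hlam0, hlam1⟩ := hlam
  have hμ : ∀ x, 0 ≤ μ x := fun x => (hμpos x).le
  have ha0 : 0 ≤ lam * γ := by positivity
  have ha1 : lam * γ < 1 := by nlinarith
  have hc : 0 ≤ (1 - lam) * γ := mul_nonneg (by linarith) hγ0.le
  have hA := isUnit_det_one_sub_smul hμpos hP0 hP1 hstat ha0 ha1
  obtain ⟨A, hAdef⟩ : ∃ A, A = (1 : Matrix (Fin NN) (Fin NN) ℝ) - (lam * γ) • P := ⟨_, rfl⟩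
  rw [← hAdef] at hA hTlam
  have hAinv (v : Fin NN → ℝ) : A *ᵥ (A⁻¹ *ᵥ v) = v := by
    rw [mulVec_mulVec, mul_nonsing_inv _ hA, one_mulVec]
  have hAapp (v : Fin NN → ℝ) : A *ᵥ v = v - (lam * γ) • (P *ᵥ v) := by
    rw [hAdef, sub_mulVec, one_mulVec, smul_mulVec]
  have hfix : Tlam V = V := by
    rw [hTlam]
    obtain ⟨u, hu⟩ : ∃ u, u = A⁻¹ *ᵥ V := ⟨_, rfl⟩
    have hVu : V = u - (lam * γ) • (P *ᵥ u) := by rw [← hAapp, hu, hAinv]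
    have hr : r = A *ᵥ (u - γ • (P *ᵥ u)) := by
      rw [eq_sub_of_add_eq hV.symm, hVu, hAapp]
      simp only [mulVec_sub, mulVec_smul]
      module
    rw [← hu, hr, mulVec_mulVec, nonsing_inv_mul _ hA, one_mulVec]
    conv_rhs => rw [hVu]
    module
  have hdiff : Tlam V - Tlam Vbar = ((1 - lam) * γ) • (P *ᵥ (A⁻¹ *ᵥ (V - Vbar))) := by
    rw [hTlam, hTlam, mulVec_sub, mulVec_sub]
    module
  have hcontr : (1 - lam * γ) * weightedNorm μ (Tlam V - Tlam Vbar) ≤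
      (1 - lam) * γ * weightedNorm μ (V - Vbar) := by
    have hres := weightedNorm_le_sub_smul_mulVec hμ hP0 hP1 hstat ha0 (A⁻¹ *ᵥ (V - Vbar))
    rw [← hAdef, hAinv] at hres
    have hP := weightedNorm_mulVec_le hμ hP0 hP1 hstat (A⁻¹ *ᵥ (V - Vbar))
    rw [hdiff, weightedNorm_smul hμ hc, mul_left_comm]
    exact mul_le_mul_of_nonneg_left
      ((mul_le_mul_of_nonneg_left hP (by linarith)).trans hres) hc
  have htri : weightedNorm μ (V - Vbar) ≤
      weightedNorm μ (V - PiG *ᵥ V) + weightedNorm μ (Tlam V - Tlam Vbar) := by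
    have hsplit : V - Vbar = (V - PiG *ᵥ V) + PiG *ᵥ (Tlam V - Tlam Vbar) := by
      rw [mulVec_sub, ← hVbar, hfix, sub_add_sub_cancel]
    have hproj : weightedNorm μ (PiG *ᵥ (Tlam V - Tlam Vbar)) ≤
        weightedNorm μ (Tlam V - Tlam Vbar) :=
      hPiG ▸ weightedNorm_projection_le hμ Ψ _
    calc weightedNorm μ (V - Vbar)
        = weightedNorm μ ((V - PiG *ᵥ V) + PiG *ᵥ (Tlam V - Tlam Vbar)) := congrArg _ hsplit
      _ ≤ _ := (weightedNorm_add_le hμ _ _).trans (by linarith)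
  change weightedNorm μ (V - Vbar) ≤
    (1 - lam * γ) / (1 - γ) * weightedNorm μ (V - PiG *ᵥ V)
  rw [div_mul_eq_mul_div, le_div_iff₀ (by linarith)]
  have h := mul_le_mul_of_nonneg_left htri (by linarith : 0 ≤ 1 - lam * γ)
  linarith
end
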